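/- Let P(R) be the space of Borel probability measures on R equipped with the topology of weak convergence. The set D^free of all probability measures on R that belong to the maximum free domain of attraction is a set of the first Baire category (i.e., meagre) in P(R). -/

import Mathlib

open MeasureTheory Filter Topology Set NNReal

/-- The cumulative distribution function of a Borel probability measure on `ℝ`:
`F(x) = μ((-∞, x])`. -/
noncomputable def distrib (μ : ProbabilityMeasure ℝ) (x : ℝ) : ℝ :=
  (μ (Set.Iic x) : ℝ≥0)

/-- The free maximum convolution of two distribution functions:
`H(x) = max {0, F(x) + G(x) - 1}`. -/
noncomputable def freeMaxConv (F G : ℝ → ℝ) : ℝ → ℝ :=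
  fun x => max 0 (F x + G x - 1)

/-- The `n`-fold free maximum convolution `F^{free ∨ n}` of a distribution function `F`
with itself (the constant function `1` is the neutral element of `freeMaxConv` on
distribution functions, so `freePow F 1 = F` pointwise for any cdf `F`). -/
noncomputable def freePow (F : ℝ → ℝ) : ℕ → ℝ → ℝ
  | 0 => fun _ => 1
  | n + 1 => freeMaxConv (freePow F n) F

/-- `μ` belongs to the maximum free domain of attraction `D^free`: there are `a n > 0`,
`b n`, and a nondegenerate limit distribution `G` such that
`F^{free ∨ n} (a n * x + b n) → G x` at every continuity point `x` of `G`. -/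
def MemFreeDomAttr (μ : ProbabilityMeasure ℝ) : Prop :=
  ∃ a b : ℕ → ℝ, (∀ n, 0 < a n) ∧
    ∃ G : ProbabilityMeasure ℝ,
      (∀ c : ℝ, (G : Measure ℝ) ≠ Measure.dirac c) ∧
      ∀ x : ℝ, ContinuousAt (distrib G) x →
        Tendsto (fun n : ℕ => freePow (distrib μ) n (a n * x + b n)) atTop (𝓝 (distrib G x))

lemma distrib_eq_cdf (μ : ProbabilityMeasure ℝ) :
    distrib μ = ProbabilityTheory.cdf (μ : Measure ℝ) := by
  funext x
  rw [ProbabilityTheory.cdf_eq_real]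
  rfl

lemma one_sub_distrib (μ : ProbabilityMeasure ℝ) (x : ℝ) :
    1 - distrib μ x = (μ : Measure ℝ).real (Ioi x) := by
  have h : (μ : Measure ℝ).real (Iic x)ᶜ = 1 - (μ : Measure ℝ).real (Iic x) :=
    probReal_compl_eq_one_sub measurableSet_Iic
  rw [compl_Iic] at h
  rw [h]
  rfl

lemma distrib_mono (μ : ProbabilityMeasure ℝ) : Monotone (distrib μ) := by
  rw [distrib_eq_cdf]; exact ProbabilityTheory.monotone_cdf _

lemma distrib_le_one (μ : ProbabilityMeasure ℝ) (x : ℝ) : distrib μ x ≤ 1 := by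
  rw [distrib_eq_cdf]; exact ProbabilityTheory.cdf_le_one _ _

lemma distrib_nonneg (μ : ProbabilityMeasure ℝ) (x : ℝ) : 0 ≤ distrib μ x := by
  rw [distrib_eq_cdf]; exact ProbabilityTheory.cdf_nonneg _ _

lemma freePow_eq (F : ℝ → ℝ) (hF : ∀ x, F x ≤ 1) (n : ℕ) (x : ℝ) :
    freePow F n x = max 0 (1 - n * (1 - F x)) := by
  induction n with
  | zero => simp [freePow]
  | succ n ih =>
    simp only [freePow, freeMaxConv, ih]
    have := hF x
    push_cast
    rcases le_total 0 (1 - n * (1 - F x)) with h | h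
    · rw [max_eq_right h]; congr 1; ring
    · rw [max_eq_left h, max_eq_left, max_eq_left] <;> nlinarith

lemma exists_cont_between (G : ProbabilityMeasure ℝ) {a b : ℝ} (h : a < b) :
    ∃ x, a < x ∧ x < b ∧ ContinuousAt (distrib G) x := by
  have hc := (distrib_mono G).countable_not_continuousAt
  have hd := hc.dense_compl ℝ
  obtain ⟨x, hx, hx'⟩ := hd.exists_between h
  refine ⟨x, hx'.1, hx'.2, ?_⟩
  simpa using hx

lemma exists_pair (G : ProbabilityMeasure ℝ)
    (hG : ∀ c : ℝ, (G : Measure ℝ) ≠ Measure.dirac c) :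
    ∃ x y, x < y ∧ ContinuousAt (distrib G) x ∧ ContinuousAt (distrib G) y ∧
      0 < distrib G x ∧ distrib G y < 1 := by
  by_contra! hcon
  have hmono := distrib_mono G
  have key : ∀ x y, x < y → 0 < distrib G x → distrib G y = 1 := by
    intro x y hxy hx
    obtain ⟨x', h1, h2, h3⟩ := exists_cont_between G hxy
    obtain ⟨y', h4, h5, h6⟩ := exists_cont_between G h2
    have := hcon x' y' h4 h3 h6 (hx.trans_le (hmono h1.le))
    exact le_antisymm (distrib_le_one G y) (this.trans (hmono h5.le))
  have hbot : Tendsto (distrib G) atBot (𝓝 0) := by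
    rw [distrib_eq_cdf]; exact ProbabilityTheory.tendsto_cdf_atBot _
  have htop : Tendsto (distrib G) atTop (𝓝 1) := by
    rw [distrib_eq_cdf]; exact ProbabilityTheory.tendsto_cdf_atTop _
  obtain ⟨t, ht⟩ := (htop.eventually_const_lt (show (0:ℝ) < 1 by norm_num)).exists
  obtain ⟨l, hl⟩ := (hbot.eventually_lt_const (show (0:ℝ) < 1 by norm_num)).exists
  set A := {x | 0 < distrib G x} with hA
  have hne : A.Nonempty := ⟨t, ht⟩
  have hbd : BddBelow A := by
    refine ⟨l, fun x hx => ?_⟩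
    by_contra! hlt
    have := key x l hlt hx
    linarith
  set c := sInf A with hc
  have hgt : ∀ y, c < y → distrib G y = 1 := by
    intro y hy
    obtain ⟨x, hx, hxy⟩ := (csInf_lt_iff hbd hne).1 hy
    exact key x y hxy hx
  have hlt : ∀ y, y < c → distrib G y = 0 := by
    intro y hy
    have : y ∉ A := fun h => absurd (csInf_le hbd h) (not_le.2 hy)
    exact le_antisymm (not_lt.1 this) (distrib_nonneg G y)
  have hcc : distrib G c = 1 := by
    have hr : ContinuousWithinAt (distrib G) (Ioi c) c := by
      rw [distrib_eq_cdf]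
      exact ((ProbabilityTheory.cdf (G : Measure ℝ)).right_continuous c).mono Ioi_subset_Ici_self
    refine tendsto_nhds_unique hr.tendsto ?_
    refine (tendsto_const_nhds (x := (1:ℝ))).congr' ?_
    filter_upwards [self_mem_nhdsWithin] with y hy
    exact (hgt y hy).symm
  refine hG c (Measure.ext_of_Iic _ _ fun y => ?_)
  have e : (G : Measure ℝ) (Iic y) = ENNReal.ofReal (distrib G y) := by
    rw [distrib_eq_cdf, ProbabilityTheory.ofReal_cdf]
  rw [e, Measure.dirac_apply' _ measurableSet_Iic]
  rcases lt_trichotomy y c with h | h | h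
  · rw [hlt y h]; simp [h]
  · rw [h, hcc]; simp
  · rw [hgt y h]; simp [h.le]

lemma exists_triple (G : ProbabilityMeasure ℝ)
    (hG : ∀ c : ℝ, (G : Measure ℝ) ≠ Measure.dirac c) :
    ∃ w x y, x < y ∧ ContinuousAt (distrib G) w ∧
      ContinuousAt (distrib G) x ∧ ContinuousAt (distrib G) y ∧
      distrib G w < distrib G x ∧ distrib G y < 1 := by
  obtain ⟨x, y, hxy, hx, hy, h0, h1⟩ := exists_pair G hG
  have hbot : Tendsto (distrib G) atBot (𝓝 0) := by
    rw [distrib_eq_cdf]; exact ProbabilityTheory.tendsto_cdf_atBot _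
  obtain ⟨l, hl⟩ := (hbot.eventually_lt_const h0).exists
  obtain ⟨w, -, hw, hwc⟩ := exists_cont_between G (sub_one_lt l)
  exact ⟨w, x, y, hxy, hwc, hx, hy, ((distrib_mono G) hw.le).trans_lt hl, h1⟩

/-- Measures whose tail is nearly flat over a long stretch and then drops in a short one. -/
def Plateau (K : ℝ) (q r s m : ℝ) : Set (ProbabilityMeasure ℝ) :=
  {μ | (μ : Measure ℝ).real (Ici q) < m * (1 + 1 / K) ∧
    m * (1 - 1 / K) < (μ : Measure ℝ).real (Ioi r) ∧ (μ : Measure ℝ).real (Ici s) < m * (1 / K)}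

lemma isOpen_lt_real {O : Set ℝ} (hO : IsOpen O) (c : ℝ) :
    IsOpen {μ : ProbabilityMeasure ℝ | c < (μ : Measure ℝ).real O} := by
  rw [isOpen_iff_mem_nhds]
  intro μ hμ
  simp only [mem_ofPred_eq] at hμ
  rcases lt_or_ge c 0 with hc | hc
  · exact Filter.Eventually.of_forall fun ν => hc.trans_le measureReal_nonneg
  have h1 : ENNReal.ofReal c < (μ : Measure ℝ) O := by
    rw [ENNReal.ofReal_lt_iff_lt_toReal hc (measure_ne_top _ _)]
    exact hμ
  have h2 := h1.trans_le (ProbabilityMeasure.le_liminf_measure_open_of_tendsto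
    (tendsto_id (x := 𝓝 μ)) hO)
  filter_upwards [eventually_lt_of_lt_liminf h2] with ν hν
  rw [ENNReal.ofReal_lt_iff_lt_toReal hc (measure_ne_top _ _)] at hν
  exact hν

lemma isOpen_real_lt {C : Set ℝ} (hC : IsClosed C) (c : ℝ) :
    IsOpen {μ : ProbabilityMeasure ℝ | (μ : Measure ℝ).real C < c} := by
  convert isOpen_lt_real hC.isOpen_compl (1 - c) using 1
  ext μ
  simp only [mem_ofPred_eq]
  rw [probReal_compl_eq_one_sub hC.measurableSet]
  constructor <;> intro h <;> linarith

lemma isOpen_plateau (K q r s m : ℝ) : IsOpen (Plateau K q r s m) :=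
  (isOpen_real_lt isClosed_Ici _).inter
    ((isOpen_lt_real isOpen_Ioi _).inter (isOpen_real_lt isClosed_Ici _))

def GoodSet (K : ℝ) : Set (ProbabilityMeasure ℝ) :=
  ⋃ (q : ℝ) (r : ℝ) (s : ℝ) (m : ℝ) (_ : 0 < m ∧ m < 1 / K ∧ K * (s - r) ≤ r - q),
    Plateau K q r s m

lemma isOpen_goodSet (K : ℝ) : IsOpen (GoodSet K) :=
  isOpen_iUnion fun _ => isOpen_iUnion fun _ => isOpen_iUnion fun _ => isOpen_iUnion fun _ =>
    isOpen_iUnion fun _ => isOpen_plateau _ _ _ _ _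

/-- Mixture of `μ` with a point mass. -/
noncomputable def mixDirac (μ : ProbabilityMeasure ℝ) (m : ℝ) (hm : 0 ≤ m) (hm1 : m ≤ 1) (p : ℝ) :
    ProbabilityMeasure ℝ :=
  ⟨ENNReal.ofReal (1 - m) • (μ : Measure ℝ) + ENNReal.ofReal m • Measure.dirac p, ⟨by
    simp only [Measure.coe_add, Measure.coe_smul, Pi.add_apply, Pi.smul_apply, measure_univ,
      smul_eq_mul, mul_one]
    rw [← ENNReal.ofReal_add (by linarith) hm]
    simp⟩⟩

lemma mixDirac_real (μ : ProbabilityMeasure ℝ) (m : ℝ) (hm : 0 ≤ m) (hm1 : m ≤ 1) (p : ℝ)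
    (A : Set ℝ) : (mixDirac μ m hm hm1 p : Measure ℝ).real A =
      (1 - m) * (μ : Measure ℝ).real A + m * (Measure.dirac p).real A := by
  have h1m : 0 ≤ 1 - m := by linarith
  simp only [mixDirac, ProbabilityMeasure.coe_mk, Measure.real, Measure.coe_add, Measure.coe_smul,
    Pi.add_apply, Pi.smul_apply, smul_eq_mul]
  rw [ENNReal.toReal_add (by finiteness) (by finiteness), ENNReal.toReal_mul, ENNReal.toReal_mul,
    ENNReal.toReal_ofReal h1m, ENNReal.toReal_ofReal hm]

lemma mixDirac_integral (μ : ProbabilityMeasure ℝ) (m : ℝ) (hm : 0 ≤ m) (hm1 : m ≤ 1) (p : ℝ)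
    (f : BoundedContinuousFunction ℝ ℝ) : ∫ x, f x ∂(mixDirac μ m hm hm1 p : Measure ℝ) =
      (1 - m) * ∫ x, f x ∂(μ : Measure ℝ) + m * f p := by
  have h1m : 0 ≤ 1 - m := by linarith
  simp only [mixDirac, ProbabilityMeasure.coe_mk]
  rw [integral_add_measure, integral_smul_measure, integral_smul_measure, integral_dirac,
    ENNReal.toReal_ofReal h1m, ENNReal.toReal_ofReal hm]
  · rfl
  · exact (f.integrable _).smul_measure (by finiteness)
  · exact (f.integrable _).smul_measure (by finiteness)

lemma tendsto_tail (μ : ProbabilityMeasure ℝ) {ε : ℝ} (hε : 0 < ε) :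
    ∃ q, (μ : Measure ℝ).real (Ici q) < ε := by
  have htop : Tendsto (distrib μ) atTop (𝓝 1) := by
    rw [distrib_eq_cdf]; exact ProbabilityTheory.tendsto_cdf_atTop _
  obtain ⟨t, ht⟩ := (htop.eventually_const_lt (show 1 - ε < 1 by linarith)).exists
  refine ⟨t + 1, ?_⟩
  have h := one_sub_distrib μ t
  have : (μ : Measure ℝ).real (Ici (t + 1)) ≤ (μ : Measure ℝ).real (Ioi t) :=
    measureReal_mono (fun x hx => by simp at hx ⊢; linarith)
  linarith

lemma dense_goodSet (K : ℝ) (hK : 1 ≤ K) : Dense (GoodSet K) := by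
  intro μ
  have hK0 : 0 < K := by linarith
  have hpos : ∀ j : ℕ, 0 < 1 / (K + 1 + j) := fun j => by positivity
  have hle : ∀ j : ℕ, 1 / (K + 1 + j) < 1 / K := fun j => by
    apply one_div_lt_one_div_of_lt hK0
    have : (0:ℝ) ≤ j := by positivity
    linarith
  have hK1 : 1 / K ≤ 1 := by rw [div_le_one hK0]; exact hK
  choose q hq using fun j : ℕ => tendsto_tail μ
    (show 0 < 1 / (K + 1 + j) * (1 / K) by have := hpos j; positivity)
  let ν : ℕ → ProbabilityMeasure ℝ := fun j =>
    mixDirac μ (1 / (K + 1 + j)) (hpos j).le ((hle j).le.trans hK1) (q j + K + 1 / 2)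
  have hm0 : Tendsto (fun j : ℕ => 1 / (K + 1 + (j : ℝ))) atTop (𝓝 0) := by
    refine Tendsto.div_atTop tendsto_const_nhds ?_
    exact tendsto_atTop_add_const_left _ _ tendsto_natCast_atTop_atTop
  have hν : Tendsto ν atTop (𝓝 μ) := by
    rw [ProbabilityMeasure.tendsto_iff_forall_integral_tendsto]
    intro f
    simp only [ν, mixDirac_integral]
    have h2 : Tendsto (fun j : ℕ => 1 / (K + 1 + (j : ℝ)) * f (q j + K + 1 / 2)) atTop (𝓝 0) := by
      refine squeeze_zero_norm (a := fun j : ℕ => 1 / (K + 1 + (j : ℝ)) * ‖f‖) ?_ ?_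
      · intro j
        rw [norm_mul, Real.norm_of_nonneg (hpos j).le]
        exact mul_le_mul_of_nonneg_left (f.norm_coe_le_norm _) (hpos j).le
      · simpa using hm0.mul_const ‖f‖
    have h1 := ((tendsto_const_nhds (x := (1:ℝ))).sub hm0).mul_const (∫ x, f x ∂(μ : Measure ℝ))
    simpa using h1.add h2
  refine mem_closure_of_tendsto hν (Eventually.of_forall fun j => ?_)
  have hj := hpos j
  have hj' := hle j
  have hqj := hq j
  simp only [GoodSet, mem_iUnion]
  refine ⟨q j, q j + K, q j + K + 1, 1 / (K + 1 + j), ⟨hj, hj', by linarith⟩, ?_⟩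
  have hKi : 0 < 1 / K := by positivity
  generalize hm : 1 / (K + 1 + (j:ℝ)) = m at *
  have d : ∀ A : Set ℝ, MeasurableSet A → (Measure.dirac (q j + K + 1 / 2)).real A =
      A.indicator 1 (q j + K + 1 / 2) := by
    intro A hA
    rw [Measure.real, Measure.dirac_apply' _ hA]
    by_cases h : q j + K + 1 / 2 ∈ A
    · rw [indicator_of_mem h, indicator_of_mem h]; simp
    · rw [indicator_of_notMem h, indicator_of_notMem h]; simp
  have hνr : ∀ A, (ν j : Measure ℝ).real A = (1 - m) * (μ : Measure ℝ).real A +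
      m * (Measure.dirac (q j + K + 1 / 2)).real A := by
    intro A
    simp only [ν, mixDirac_real, hm]
  have hn : ∀ A, 0 ≤ (μ : Measure ℝ).real A := fun A => measureReal_nonneg
  refine ⟨?_, ?_, ?_⟩
  · rw [hνr, d _ measurableSet_Ici, indicator_of_mem (by simp; linarith)]
    simp only [Pi.one_apply]
    nlinarith [hn (Ici (q j))]
  · rw [hνr, d _ measurableSet_Ioi, indicator_of_mem (by simp)]
    simp only [Pi.one_apply]
    nlinarith [mul_nonneg (show 0 ≤ 1 - m by linarith) (hn (Ioi (q j + K)))]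
  · rw [hνr, d _ measurableSet_Ici, indicator_of_notMem (by simp; linarith)]
    have : (μ : Measure ℝ).real (Ici (q j + K + 1)) ≤ (μ : Measure ℝ).real (Ici (q j)) :=
      measureReal_mono (Ici_subset_Ici.2 (by linarith))
    nlinarith [hn (Ici (q j + K + 1))]

lemma not_mem_of_good (μ : ProbabilityMeasure ℝ) (h : ∀ k : ℕ, μ ∈ GoodSet ((k : ℝ) + 1)) :
    ¬ MemFreeDomAttr μ := by
  rintro ⟨a, b, ha, G, hG, hconv⟩
  obtain ⟨w, x, y, hxy, hw, hx, hy, hwx, hy1⟩ := exists_triple G hG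
  simp only [GoodSet, mem_iUnion] at h
  choose q r s m hm hP using h
  set S : ℝ → ℝ := fun z => (μ : Measure ℝ).real (Ioi z) with hS
  have hSanti : ∀ u v, S u < S v → v < u := by
    intro u v huv
    by_contra! hle
    exact absurd (measureReal_mono (Ioi_subset_Ioi hle) : S v ≤ S u) (not_le.2 huv)
  have hT : ∀ z, ContinuousAt (distrib G) z →
      Tendsto (fun n : ℕ => min 1 (n * S (a n * z + b n))) atTop (𝓝 (1 - distrib G z)) := by
    intro z hz
    refine ((tendsto_const_nhds (x := (1:ℝ))).sub (hconv z hz)).congr fun n => ?_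
    rw [freePow_eq _ (distrib_le_one μ), one_sub_distrib]
    rw [← min_sub_sub_left]
    simp [hS]
  obtain ⟨c, hcx, hcw⟩ : ∃ c, 1 - distrib G x < c ∧ c < 1 - distrib G w :=
    exists_between (by linarith)
  have hc0 : 0 < c := by have := distrib_le_one G x; linarith
  have hc1 : c < 1 := by have := distrib_nonneg G w; linarith
  set N : ℕ → ℕ := fun k => ⌈c / m k⌉₊ with hN
  have hKinv : Tendsto (fun k : ℕ => 1 / ((k : ℝ) + 1)) atTop (𝓝 0) :=
    tendsto_one_div_add_atTop_nhds_zero_nat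
  have hm0 : Tendsto m atTop (𝓝 0) :=
    squeeze_zero (fun k => (hm k).1.le) (fun k => (hm k).2.1.le) hKinv
  have hNlow : ∀ k, c ≤ N k * m k := fun k => by
    have := Nat.le_ceil (c / m k)
    rwa [div_le_iff₀ (hm k).1] at this
  have hNup : ∀ k, N k * m k ≤ c + m k := fun k => by
    have := (Nat.ceil_lt_add_one (div_pos hc0 (hm k).1).le).le
    have h2 := mul_le_mul_of_nonneg_right this (hm k).1.le
    rwa [add_mul, div_mul_cancel₀ _ (hm k).1.ne', one_mul] at h2
  have hNm : Tendsto (fun k => N k * m k) atTop (𝓝 c) :=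
    tendsto_of_tendsto_of_tendsto_of_le_of_le tendsto_const_nhds
      (by simpa using (tendsto_const_nhds (x := c)).add hm0) hNlow hNup
  have hNtop : Tendsto N atTop atTop := by
    rw [← tendsto_natCast_atTop_iff (R := ℝ)]
    have h1 : Tendsto (fun k : ℕ => c * ((k : ℝ) + 1)) atTop atTop :=
      (tendsto_atTop_add_const_right _ _ tendsto_natCast_atTop_atTop).const_mul_atTop hc0
    refine tendsto_atTop_mono (fun k => ?_) h1
    have hk : (0:ℝ) < k + 1 := by positivity
    have h3 := (hm k).2.1
    rw [lt_div_iff₀ hk] at h3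
    have h4 := hNlow k
    have h5 : (0:ℝ) ≤ N k := by positivity
    nlinarith
  have l1 : Tendsto (fun k : ℕ => N k * m k * (1 + 1 / ((k : ℝ) + 1))) atTop (𝓝 c) := by
    simpa using hNm.mul ((tendsto_const_nhds (x := (1:ℝ))).add hKinv)
  have l2 : Tendsto (fun k : ℕ => N k * m k * (1 - 1 / ((k : ℝ) + 1))) atTop (𝓝 c) := by
    simpa using hNm.mul ((tendsto_const_nhds (x := (1:ℝ))).sub hKinv)
  have l3 : Tendsto (fun k : ℕ => N k * m k * (1 / ((k : ℝ) + 1))) atTop (𝓝 0) := by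
    simpa using hNm.mul hKinv
  have e1 := l1.eventually_lt ((hT w hw).comp hNtop) hcw
  have e2 := ((hT x hx).comp hNtop).eventually_lt l2 hcx
  have e2' := l2.eventually_lt_const hc1
  have e3 := l3.eventually_lt ((hT y hy).comp hNtop) (show 0 < 1 - distrib G y by linarith)
  obtain ⟨k0, hk0⟩ := exists_nat_gt ((x - w) / (y - x))
  obtain ⟨k, f1, f2, f2', f3, hk⟩ :=
    (e1.and (e2.and (e2'.and (e3.and (eventually_ge_atTop k0))))).exists
  simp only [Function.comp] at f1 f2 f3
  obtain ⟨p1, p2, p3⟩ := hP k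
  have hsub : ∀ z, S z ≤ (μ : Measure ℝ).real (Ici z) := fun z =>
    measureReal_mono Ioi_subset_Ici_self
  have hNk : (0:ℝ) < N k := by
    have := hNlow k
    by_contra! hcon
    nlinarith [(hm k).1]
  have g1 : a (N k) * w + b (N k) < q k := by
    apply hSanti
    have := f1.trans_le (min_le_right _ _)
    rw [mul_assoc] at this
    exact ((hsub _).trans_lt p1).trans (lt_of_mul_lt_mul_left this hNk.le)
  have g2 : r k < a (N k) * x + b (N k) := by
    apply hSanti
    have : N k * S (a (N k) * x + b (N k)) < N k * m k * (1 - 1 / ((k : ℝ) + 1)) := by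
      rcases min_lt_iff.1 f2 with h | h
      · linarith
      · exact h
    rw [mul_assoc] at this
    exact (lt_of_mul_lt_mul_left this hNk.le).trans p2
  have g3 : a (N k) * y + b (N k) < s k := by
    apply hSanti
    have := f3.trans_le (min_le_right _ _)
    rw [mul_assoc] at this
    exact ((hsub _).trans_lt p3).trans (lt_of_mul_lt_mul_left this hNk.le)
  have hgap := (hm k).2.2
  have hk' : (k0 : ℝ) ≤ k := by exact_mod_cast hk
  rw [div_lt_iff₀ (by linarith)] at hk0
  have hkk : (0:ℝ) < k + 1 := by positivity
  have t1 : ((k:ℝ) + 1) * (a (N k) * (y - x)) < a (N k) * (x - w) := by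
    have := mul_lt_mul_of_pos_left (show a (N k) * (y - x) < s k - r k by linarith) hkk
    linarith
  have t2 : ((k:ℝ) + 1) * (y - x) < x - w := by
    refine lt_of_mul_lt_mul_left ?_ (ha (N k)).le
    linarith
  nlinarith

/-- The set `D^free` of distributions on `ℝ` in the maximum free domain of attraction is
meagre (of the first Baire category) in the space of Borel probability measures on `ℝ`
with the topology of weak convergence. -/
theorem meagre_free_domain_of_attraction :
    IsMeagre {μ : ProbabilityMeasure ℝ | MemFreeDomAttr μ} := by
  have h : (⋂ k : ℕ, GoodSet ((k : ℝ) + 1)) ∈ residual (ProbabilityMeasure ℝ) :=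
    countable_iInter_mem.2 fun k => residual_of_dense_open (isOpen_goodSet _)
      (dense_goodSet _ (by linarith [(Nat.cast_nonneg k : (0:ℝ) ≤ k)]))
  refine mem_of_superset h fun μ hμ => ?_
  exact not_mem_of_good μ (mem_iInter.1 hμ)
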